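/- arXiv:2303.16595 — 3 statements merged into one kernel-verified Lean document; each statement's English description precedes it below -/
import Mathlib

section
/- Let n, p, q be finite index types, let G : (n → ℝ) → (n → ℝ) be continuous, and let A, C : Matrix p n ℝ and B, D : Matrix q n ℝ. Say that a triple (y, φ, λ) with y : n → ℝ, φ : p → ℝ, λ : q → ℝ solves the mixed complementarity system with data (e, f), where e : p → ℝ and f : q → ℝ, if: y ≥ 0 componentwise; G y + Aᵀ.mulVec φ + Bᵀ.mulVec λ ≥ 0 componentwise; ∑_i y i * (G y + Aᵀ.mulVec φ + Bᵀ.mulVec λ) i = 0; C.mulVec y = e; D.mulVec y − f ≥ 0 componentwise; λ ≥ 0 componentwise; and ∑_j λ j * (D.mulVec y − f) j = 0. Suppose (e_k, f_k) is a sequence of data with e_k → e_∞ and f_k → f_∞, that (y_k, φ_k, λ_k) solves the system with data (e_k, f_k) for every k, and that y_k → y_∞. Then there exist φ_∞ : p → ℝ and λ_∞ : q → ℝ such that (y_∞, φ_∞, λ_∞) solves the system with data (e_∞, f_∞). -/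
open Filter

/-- A triple `(y, φ, lam)` solves the mixed complementarity system with data
`(e, f)`. -/
def MCPSolves {n p q : Type*} [Fintype n] [Fintype p] [Fintype q]
    (G : (n → ℝ) → (n → ℝ)) (A : Matrix p n ℝ) (B : Matrix q n ℝ)
    (C : Matrix p n ℝ) (D : Matrix q n ℝ)
    (e : p → ℝ) (f : q → ℝ)
    (y : n → ℝ) (φ : p → ℝ) (lam : q → ℝ) : Prop :=
  (∀ i, 0 ≤ y i) ∧
  (∀ i, 0 ≤ (G y + A.transpose.mulVec φ + B.transpose.mulVec lam) i) ∧
  (∑ i, y i * (G y + A.transpose.mulVec φ + B.transpose.mulVec lam) i) = 0 ∧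
  C.mulVec y = e ∧
  (∀ j, 0 ≤ (D.mulVec y - f) j) ∧
  (∀ j, 0 ≤ lam j) ∧
  (∑ j, lam j * (D.mulVec y - f) j) = 0

open Topology

/-- A conic combination of linearly dependent vectors can be rewritten without one of them. -/
theorem exists_nonneg_sum_erase_of_not_linearIndepOn {ι E : Type*} [DecidableEq ι]
    [AddCommGroup E] [Module ℝ E] {v : ι → E} {s : Finset ι}
    (hs : ¬ LinearIndepOn ℝ v (s : Set ι)) {c : ι → ℝ} (hc : ∀ i, 0 ≤ c i) :
    ∃ i ∈ s, ∃ d : ι → ℝ, (∀ j, 0 ≤ d j) ∧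
      ∑ j ∈ s.erase i, d j • v j = ∑ j ∈ s, c j • v j := by
  obtain ⟨g, hg, i₁, hi₁, hpos⟩ :
      ∃ g : ι → ℝ, ∑ i ∈ s, g i • v i = 0 ∧ ∃ i ∈ s, 0 < g i := by
    rw [not_linearIndepOn_finset_iff] at hs
    obtain ⟨g, hg, i, hi, hne⟩ := hs
    rcases hne.lt_or_gt with h | h
    · exact ⟨fun j => -g j, by simp [hg], i, hi, by simpa using h⟩
    · exact ⟨g, hg, i, hi, h⟩
  obtain ⟨i₀, hi₀, hmin⟩ := (s.filter (fun i => 0 < g i)).exists_min_image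
    (fun i => c i / g i) ⟨i₁, by simp [hi₁, hpos]⟩
  simp only [Finset.mem_filter] at hi₀ hmin
  have hr : 0 ≤ c i₀ / g i₀ := div_nonneg (hc i₀) hi₀.2.le
  have hd : ∀ j ∈ s, 0 ≤ c j - c i₀ / g i₀ * g j := by
    intro j hj
    by_cases hgj : 0 < g j
    · have := hmin j ⟨hj, hgj⟩
      rw [le_div_iff₀ hgj] at this
      linarith
    · have := mul_nonpos_of_nonneg_of_nonpos hr (not_lt.mp hgj)
      linarith [hc j]
  refine ⟨i₀, hi₀.1, fun j => if j ∈ s then c j - c i₀ / g i₀ * g j else 0, ?_, ?_⟩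
  · intro j
    dsimp only
    split_ifs with hj
    · exact hd j hj
    · exact le_rfl
  · have hz : c i₀ - c i₀ / g i₀ * g i₀ = 0 := by
      rw [div_mul_cancel₀ _ hi₀.2.ne', sub_self]
    rw [Finset.sum_erase _ (by simp [hi₀.1, hz])]
    calc ∑ j ∈ s, (if j ∈ s then c j - c i₀ / g i₀ * g j else 0) • v j
        = ∑ j ∈ s, (c j • v j - (c i₀ / g i₀) • g j • v j) :=
          Finset.sum_congr rfl fun j hj => by rw [if_pos hj, sub_smul, mul_smul]
      _ = ∑ j ∈ s, c j • v j := by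
          rw [Finset.sum_sub_distrib, ← Finset.smul_sum, hg, smul_zero, sub_zero]

/-- A finitely generated convex cone is closed. -/
theorem isClosed_setOf_nonneg_sum_smul {ι E : Type*} [AddCommGroup E] [Module ℝ E]
    [TopologicalSpace E] [IsTopologicalAddGroup E] [ContinuousSMul ℝ E] [T2Space E]
    (v : ι → E) (s : Finset ι) :
    IsClosed {x | ∃ c : ι → ℝ, (∀ i, 0 ≤ c i) ∧ ∑ i ∈ s, c i • v i = x} := by
  classical
  induction s using Finset.strongInduction with
  | H s ih =>
    by_cases hs : LinearIndepOn ℝ v (s : Set ι)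
    · let L := Fintype.linearCombination ℝ (fun i : s => v i)
      have hL : LinearMap.ker L = ⊥ :=
        LinearMap.ker_eq_bot.mpr (LinearIndependent.fintypeLinearCombination_injective hs)
      convert (LinearMap.isClosedEmbedding_of_injective hL).isClosedMap _
        (isClosed_Ici (a := (0 : s → ℝ))) using 1
      ext x
      simp only [Set.mem_ofPred_eq, Set.mem_image, Set.mem_Ici]
      constructor
      · rintro ⟨c, hc, rfl⟩
        refine ⟨fun i => c i, fun i => hc i, ?_⟩
        simp only [L, Fintype.linearCombination_apply]
        exact Finset.sum_coe_sort s (fun i => c i • v i)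
      · rintro ⟨c, hc, rfl⟩
        refine ⟨fun i => if h : i ∈ s then c ⟨i, h⟩ else 0, fun i => ?_, ?_⟩
        · dsimp only
          split_ifs with h
          · exact hc ⟨i, h⟩
          · exact le_rfl
        · simp only [L, Fintype.linearCombination_apply]
          rw [← Finset.sum_coe_sort s]
          simp
    · convert s.finite_toSet.isClosed_biUnion fun i hi => ih (s.erase i) (Finset.erase_ssubset hi)
        using 1
      ext x
      simp only [Set.mem_ofPred_eq, Set.mem_iUnion, Finset.mem_coe, exists_prop]
      constructor
      · rintro ⟨c, hc, rfl⟩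
        exact exists_nonneg_sum_erase_of_not_linearIndepOn hs hc
      · rintro ⟨i, hi, c, hc, rfl⟩
        refine ⟨fun j => if j = i then 0 else c j, fun j => ?_, ?_⟩
        · dsimp only
          split_ifs
          · exact le_rfl
          · exact hc j
        · rw [← Finset.sum_erase s (a := i) (by simp)]
          exact Finset.sum_congr rfl fun j hj => by
            simp [Finset.ne_of_mem_erase hj]

/-- The set of right-hand sides for which a linear system, with free variables `φ`, nonnegative
variables `μ` vanishing on `J`, and equality required on the rows in `I`, is feasible is closed. -/
theorem isClosed_setOf_exists_multipliers {n p q : Type*} [Fintype n] [Fintype p] [Fintype q]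
    (A : Matrix p n ℝ) (B : Matrix q n ℝ) (I : Set n) (J : Set q) :
    IsClosed {x : n → ℝ | ∃ (φ : p → ℝ) (μ : q → ℝ), (∀ j, 0 ≤ μ j) ∧ (∀ j ∈ J, μ j = 0) ∧
      (∀ i, 0 ≤ (x + A.transpose.mulVec φ + B.transpose.mulVec μ) i) ∧
      ∀ i ∈ I, (x + A.transpose.mulVec φ + B.transpose.mulVec μ) i = 0} := by
  classical
  let v : p ⊕ p ⊕ q ⊕ n → n → ℝ :=
    Sum.elim (fun k => A k) (Sum.elim (fun k => -A k)
      (Sum.elim (fun j => if j ∈ J then 0 else -B j)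
        (fun i => if i ∈ I then 0 else Pi.single i 1)))
  have hv : ∀ (c : p ⊕ p ⊕ q ⊕ n → ℝ) (i : n), (∑ k, c k • v k) i =
      ∑ k, c (.inl k) * A k i - ∑ k, c (.inr (.inl k)) * A k i
        - ∑ j, (if j ∈ J then 0 else c (.inr (.inr (.inl j)))) * B j i
        + if i ∈ I then 0 else c (.inr (.inr (.inr i))) := by
    intro c i
    have h : ∑ k, c (.inr (.inr (.inr k))) * (if k ∈ I then 0 else Pi.single k (1 : ℝ) : n → ℝ) i
        = if i ∈ I then 0 else c (.inr (.inr (.inr i))) := by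
      rw [Finset.sum_eq_single i]
      · split_ifs <;> simp
      · intro k _ hk
        split_ifs <;> simp [hk.symm]
      · simp
    have h' : ∑ j, c (.inr (.inr (.inl j))) * (if j ∈ J then 0 else -B j : n → ℝ) i
        = -∑ j, (if j ∈ J then 0 else c (.inr (.inr (.inl j)))) * B j i := by
      rw [← Finset.sum_neg_distrib]
      refine Finset.sum_congr rfl fun j _ => ?_
      split_ifs <;> simp
    simp only [v, Finset.sum_apply, Pi.smul_apply, smul_eq_mul, Fintype.sum_sum_type,
      Sum.elim_inl, Sum.elim_inr, h, h', Pi.neg_apply, mul_neg, Finset.sum_neg_distrib]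
    ring
  convert isClosed_setOf_nonneg_sum_smul v Finset.univ using 1
  ext x
  simp only [Set.mem_ofPred_eq, Pi.add_apply, Matrix.mulVec, dotProduct, Matrix.transpose_apply]
  constructor
  · rintro ⟨φ, μ, hμ, hJ, hx, hI⟩
    refine ⟨Sum.elim (fun k => (φ k)⁻) (Sum.elim (fun k => (φ k)⁺) (Sum.elim μ
      (fun i => x i + ∑ k, A k i * φ k + ∑ j, B j i * μ j))), ?_, ?_⟩
    · rintro (k | k | j | i)
      · exact negPart_nonneg _
      · exact posPart_nonneg _
      · exact hμ j
      · exact hx i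
    · ext i
      rw [hv]
      simp only [Sum.elim_inl, Sum.elim_inr]
      have h1 : ∑ k, (φ k)⁻ * A k i - ∑ k, (φ k)⁺ * A k i = -∑ k, A k i * φ k := by
        rw [← Finset.sum_sub_distrib, ← Finset.sum_neg_distrib]
        refine Finset.sum_congr rfl fun k _ => ?_
        linear_combination (-A k i) * posPart_sub_negPart (φ k)
      have h2 : ∑ j, (if j ∈ J then 0 else μ j) * B j i = ∑ j, B j i * μ j := by
        refine Finset.sum_congr rfl fun j _ => ?_
        split_ifs with hj
        · simp [hJ j hj]
        · ring
      rw [h1, h2]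
      split_ifs with hi
      · linarith [hI i hi]
      · ring
  · rintro ⟨c, hc, rfl⟩
    have key : ∀ i, (∑ k, c k • v k) i
        + ∑ k, A k i * (c (.inr (.inl k)) - c (.inl k))
        + ∑ j, B j i * (if j ∈ J then 0 else c (.inr (.inr (.inl j))))
        = if i ∈ I then 0 else c (.inr (.inr (.inr i))) := by
      intro i
      rw [hv]
      simp only [mul_comm (A _ i), mul_comm (B _ i), sub_mul, Finset.sum_sub_distrib]
      ring
    refine ⟨fun k => c (.inr (.inl k)) - c (.inl k),
      fun j => if j ∈ J then 0 else c (.inr (.inr (.inl j))), fun j => ?_, fun j hj => if_pos hj,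
      fun i => ?_, fun i hi => ?_⟩
    · dsimp only
      split_ifs
      · exact le_rfl
      · exact hc _
    · rw [key]
      split_ifs
      · exact le_rfl
      · exact hc _
    · rw [key, if_pos hi]

/-- Linear complementarity limit lemma: if solutions exist along a convergent
sequence of data and the primal variables converge, then there exist limiting
multipliers solving the system with the limiting data. -/
theorem mcp_limit {n p q : Type*} [Fintype n] [Fintype p] [Fintype q]
    (G : (n → ℝ) → (n → ℝ)) (hG : Continuous G)
    (A : Matrix p n ℝ) (B : Matrix q n ℝ) (C : Matrix p n ℝ) (D : Matrix q n ℝ)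
    (e : ℕ → p → ℝ) (f : ℕ → q → ℝ) (einf : p → ℝ) (finf : q → ℝ)
    (he : Tendsto e atTop (nhds einf)) (hf : Tendsto f atTop (nhds finf))
    (y : ℕ → n → ℝ) (φ : ℕ → p → ℝ) (lam : ℕ → q → ℝ)
    (hsol : ∀ k, MCPSolves G A B C D (e k) (f k) (y k) (φ k) (lam k))
    (yinf : n → ℝ) (hy : Tendsto y atTop (nhds yinf)) :
    ∃ (φinf : p → ℝ) (laminf : q → ℝ),
      MCPSolves G A B C D einf finf yinf φinf laminf := by
  have hyi : ∀ i, Tendsto (fun k => y k i) atTop (𝓝 (yinf i)) := tendsto_pi_nhds.mp hy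
  have hslack : Tendsto (fun k => D.mulVec (y k) - f k) atTop (𝓝 (D.mulVec yinf - finf)) :=
    (((continuous_const.matrix_mulVec continuous_id).tendsto yinf).comp hy).sub hf
  have hslackj : ∀ j, Tendsto (fun k => (D.mulVec (y k) - f k) j) atTop
      (𝓝 ((D.mulVec yinf - finf) j)) := tendsto_pi_nhds.mp hslack
  have hC : C.mulVec yinf = einf := by
    refine tendsto_nhds_unique
      (((continuous_const.matrix_mulVec continuous_id).tendsto yinf).comp hy) (he.congr fun k => ?_)
    exact (hsol k).2.2.2.1.symm
  have hy0 : ∀ i, 0 ≤ yinf i := fun i => ge_of_tendsto' (hyi i) fun k => (hsol k).1 i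
  have hs0 : ∀ j, 0 ≤ (D.mulVec yinf - finf) j := fun j =>
    ge_of_tendsto' (hslackj j) fun k => (hsol k).2.2.2.2.1 j
  have hmem : ∀ᶠ k in atTop, G (y k) ∈ {x : n → ℝ | ∃ (φ : p → ℝ) (μ : q → ℝ),
      (∀ j, 0 ≤ μ j) ∧ (∀ j ∈ {j | 0 < (D.mulVec yinf - finf) j}, μ j = 0) ∧
      (∀ i, 0 ≤ (x + A.transpose.mulVec φ + B.transpose.mulVec μ) i) ∧
      ∀ i ∈ {i | 0 < yinf i}, (x + A.transpose.mulVec φ + B.transpose.mulVec μ) i = 0} := by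
    have hI : ∀ᶠ k in atTop, ∀ i, 0 < yinf i → 0 < y k i := by
      rw [eventually_all]
      exact fun i => eventually_imp_distrib_left.mpr fun h => (hyi i).eventually_const_lt h
    have hJ : ∀ᶠ k in atTop, ∀ j, 0 < (D.mulVec yinf - finf) j →
        0 < (D.mulVec (y k) - f k) j := by
      rw [eventually_all]
      exact fun j => eventually_imp_distrib_left.mpr fun h => (hslackj j).eventually_const_lt h
    filter_upwards [hI, hJ] with k hIk hJk
    obtain ⟨h1, h2, h3, -, h5, h6, h7⟩ := hsol k
    rw [Finset.sum_eq_zero_iff_of_nonneg fun i _ => mul_nonneg (h1 i) (h2 i)] at h3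
    rw [Finset.sum_eq_zero_iff_of_nonneg fun j _ => mul_nonneg (h6 j) (h5 j)] at h7
    exact ⟨φ k, lam k, h6,
      fun j hj => (mul_eq_zero.mp (h7 j (Finset.mem_univ j))).resolve_right (hJk j hj).ne', h2,
      fun i hi => (mul_eq_zero.mp (h3 i (Finset.mem_univ i))).resolve_left (hIk i hi).ne'⟩
  obtain ⟨φinf, laminf, hl, hJ, hx, hI⟩ := (isClosed_setOf_exists_multipliers A B _ _).mem_of_tendsto
    ((hG.tendsto yinf).comp hy) hmem
  refine ⟨φinf, laminf, hy0, hx, Finset.sum_eq_zero fun i _ => ?_, hC, hs0, hl,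
    Finset.sum_eq_zero fun j _ => ?_⟩
  · rcases (hy0 i).eq_or_lt with h | h
    · rw [← h, zero_mul]
    · rw [hI i h, mul_zero]
  · rcases (hs0 j).eq_or_lt with h | h
    · rw [← h, mul_zero]
    · rw [hJ j h, zero_mul]
end

section
/- Let V be a finite type, let E : Set (V × V) be a set of directed links, let c : V → V → ℝ be link costs with c i j > 0 for every (i, j) ∈ E, let x : V → V → ℝ be link flows, and let π : V → ℝ be node potentials. Assume the Wardrop complementarity conditions hold: for every (i, j) ∈ E, x i j ≥ 0, π j + c i j − π i ≥ 0, and x i j * (π j + c i j − π i) = 0. Then the links carrying positive flow contain no directed cycle: there is no k ≥ 1 and no map v : Fin (k + 1) → V with v 0 = v k such that for every t < k, (v t, v (t+1)) ∈ E and x (v t) (v (t+1)) > 0. -/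
/-- At a Wardrop equilibrium (complementarity between link flows, link costs,
and node potentials, with strictly positive link costs), the links carrying
positive flow contain no directed cycle. -/
theorem wardrop_no_positive_flow_cycle (V : Type*) [Fintype V]
    (E : Set (V × V)) (c : V → V → ℝ)
    (hc : ∀ e ∈ E, 0 < c e.1 e.2)
    (x : V → V → ℝ) (π : V → ℝ)
    (hW : ∀ e ∈ E, 0 ≤ x e.1 e.2 ∧ 0 ≤ π e.2 + c e.1 e.2 - π e.1 ∧
          x e.1 e.2 * (π e.2 + c e.1 e.2 - π e.1) = 0) :
    ¬ ∃ k : ℕ, 1 ≤ k ∧ ∃ v : Fin (k + 1) → V, v 0 = v (Fin.last k) ∧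
        ∀ t : Fin k, (v t.castSucc, v t.succ) ∈ E ∧
          0 < x (v t.castSucc) (v t.succ) := by
  rintro ⟨k, hk, v, hv, h⟩
  have hanti : StrictAnti fun t => π (v t) := Fin.strictAnti_iff_succ_lt.2 fun t => by
    obtain ⟨hE, hx⟩ := h t
    have hcost := hc _ hE
    have htight := (mul_eq_zero.1 (hW _ hE).2.2).resolve_left hx.ne'
    dsimp only at hcost htight ⊢
    linarith
  have hlt : (0 : Fin (k + 1)) < Fin.last k := Fin.lt_def.2 hk
  exact (hanti hlt).ne' (congrArg π hv)
end

section
/- Let V be a finite type, let E : Finset (V × V) be a finite set of directed links, let c : V → V → ℝ satisfy c i j ≥ 0 for every (i, j) ∈ E, let x : V → V → ℝ be nonnegative link flows, and let π : V → ℝ be nonnegative node potentials. Assume: (a) for every (i, j) ∈ E with x i j > 0, π i = π j + c i j; (b) the sub-digraph of positive-flow links {(i, j) ∈ E | x i j > 0} contains no directed cycle; and (c) for every node i, either π i = 0 or there exists j with (i, j) ∈ E and x i j > 0. Then for every node i, π i ≤ ∑_{(j,k) ∈ E} c j k. -/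
/-- Points related by the transitive closure of `R` are joined by a finite nonempty `R`-chain. -/
theorem Relation.TransGen.exists_fin_chain {V : Type*} {R : V → V → Prop} {a b : V}
    (h : Relation.TransGen R a b) :
    ∃ k : ℕ, 1 ≤ k ∧ ∃ v : Fin (k + 1) → V, v 0 = a ∧ v (Fin.last k) = b ∧
      ∀ t : Fin k, R (v t.castSucc) (v t.succ) := by
  induction h using Relation.TransGen.head_induction_on with
  | @single a h =>
    refine ⟨1, le_rfl, ![a, b], rfl, rfl, fun t => ?_⟩
    fin_cases t
    exact h
  | @head a d h _ ih =>
    obtain ⟨k, -, v, hv0, hvl, hv⟩ := ih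
    refine ⟨k + 1, by omega, Fin.cons a v, rfl, ?_, fun t => ?_⟩
    · rw [← Fin.succ_last, Fin.cons_succ, hvl]
    · induction t using Fin.cases with
      | zero => simpa [hv0] using h
      | succ t => simpa only [← Fin.succ_castSucc, Fin.cons_succ] using hv t

open Classical in
/-- A potential that decreases by the link cost along an acyclic relation, and vanishes at its
sinks, is bounded at each node by the total cost of the links reachable from that node. -/
theorem potential_le_sum_reachable {V : Type*} [Finite V] {E : Finset (V × V)}
    {c : V → V → ℝ} (hc : ∀ e ∈ E, 0 ≤ c e.1 e.2) {R : V → V → Prop}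
    (hRE : ∀ i j, R i j → (i, j) ∈ E) {p : V → ℝ}
    (hp : ∀ i j, R i j → p i = p j + c i j)
    (hR : ∀ i, ¬ Relation.TransGen R i i)
    (hsink : ∀ i, p i = 0 ∨ ∃ j, R i j) (i : V) :
    p i ≤ ∑ e ∈ E with Relation.ReflTransGen R i e.1, c e.1 e.2 := by
  have : IsTrans V (fun a b => Relation.TransGen R b a) := ⟨fun _ _ _ h₁ h₂ => h₂.trans h₁⟩
  have : Std.Irrefl (fun a b => Relation.TransGen R b a) := ⟨hR⟩
  have wf : WellFounded (fun a b => Relation.TransGen R b a) :=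
    Finite.wellFounded_of_trans_of_irrefl _
  induction i using wf.induction with
  | _ i ih =>
    rcases hsink i with h0 | ⟨j, hij⟩
    · rw [h0]
      exact Finset.sum_nonneg fun e he => hc e (Finset.mem_filter.1 he).1
    · have hnot : (i, j) ∉ E.filter (fun e => Relation.ReflTransGen R j e.1) := fun h =>
        hR i (Relation.TransGen.head' hij (Finset.mem_filter.1 h).2)
      calc p i = c i j + p j := by rw [hp i j hij, add_comm]
        _ ≤ c i j + ∑ e ∈ E with Relation.ReflTransGen R j e.1, c e.1 e.2 := by
          gcongr
          exact ih j (.single hij)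
        _ = ∑ e ∈ insert (i, j) (E.filter fun e => Relation.ReflTransGen R j e.1),
            c e.1 e.2 := by rw [Finset.sum_insert hnot]
        _ ≤ _ := by
          refine Finset.sum_le_sum_of_subset_of_nonneg ?_
            fun e he _ => hc e (Finset.mem_filter.1 he).1
          refine Finset.insert_subset (Finset.mem_filter.2 ⟨hRE i j hij, .refl⟩) fun e he => ?_
          obtain ⟨heE, hje⟩ := Finset.mem_filter.1 he
          exact Finset.mem_filter.2 ⟨heE, .head hij hje⟩

/-- Bound on equilibrium node potentials: under the equilibrium relation on
positive-flow links, acyclicity of the positive-flow sub-digraph, and the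
condition that every node with positive potential has an outgoing
positive-flow link, every node potential is bounded by the sum of all link
costs. -/
theorem node_potential_bound (V : Type*) [Fintype V]
    (E : Finset (V × V)) (c : V → V → ℝ)
    (hc : ∀ e ∈ E, 0 ≤ c e.1 e.2)
    (x : V → V → ℝ) (hx : ∀ i j, 0 ≤ x i j)
    (π : V → ℝ) (hπ : ∀ i, 0 ≤ π i)
    (ha : ∀ e ∈ E, 0 < x e.1 e.2 → π e.1 = π e.2 + c e.1 e.2)
    (hb : ¬ ∃ k : ℕ, 1 ≤ k ∧ ∃ v : Fin (k + 1) → V, v 0 = v (Fin.last k) ∧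
        ∀ t : Fin k, (v t.castSucc, v t.succ) ∈ E ∧
          0 < x (v t.castSucc) (v t.succ))
    (hcnd : ∀ i, π i = 0 ∨ ∃ j, (i, j) ∈ E ∧ 0 < x i j) :
    ∀ i, π i ≤ ∑ e ∈ E, c e.1 e.2 := by
  classical
  intro i
  have hacyc : ∀ i, ¬ Relation.TransGen (fun i j => (i, j) ∈ E ∧ 0 < x i j) i i := fun i h => by
    obtain ⟨k, hk, v, hv0, hvl, hv⟩ := h.exists_fin_chain
    exact hb ⟨k, hk, v, hv0.trans hvl.symm, hv⟩
  exact (potential_le_sum_reachable hc (fun _ _ h => h.1) (fun i j h => ha (i, j) h.1 h.2)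
    hacyc hcnd i).trans
    (Finset.sum_le_sum_of_subset_of_nonneg (Finset.filter_subset _ _) fun e he _ => hc e he)
end
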